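/- Let α, β, γ, δ, ε, ζ be real constants with ζ ≠ 0. Let f, g be C¹ functions on an open set U ⊂ ℝ² satisfying identically on U the two algebraic relations (4.3): −ζ²fg² − 12βζfg − ζ²f³ + 26αζf² − 192α²f + 6αζg² + 64αβg − 32αε + γζ + 2ζy = 0, and (4.4): ζ²f²g − 12αζfg + ζ²g³ + 26βζg² + 192β²g + 6βζf² − 64αβf + 32βε + δζ + 2ζx = 0. Define Λ = (−ζf² − ζg² + 16αf − 16βg)/(2ζ) and u₀ = 4(2αf + 2βg + ε)/ζ. Then the quadruple (Λ, u₀, f, g) satisfies the quasi-linear system (4.1) on U, namely: f_x + g_y = 0; fΛ_x + Λf_x − gΛ_y − Λg_y = 0; 2Λ_x + (u₀)_x + (g/2)g_x − (g/2)f_y = 0; and −(f/2)g_x + 2Λ_y − (u₀)_y + (f/2)f_y = 0. -/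

import Mathlib

open Real

/-- Partial derivative in the first variable of a function on `ℝ²`. -/
noncomputable def pdx (f : ℝ × ℝ → ℝ) (p : ℝ × ℝ) : ℝ := deriv (fun t => f (t, p.2)) p.1

/-- Partial derivative in the second variable of a function on `ℝ²`. -/
noncomputable def pdy (f : ℝ × ℝ → ℝ) (p : ℝ × ℝ) : ℝ := deriv (fun t => f (p.1, t)) p.2

open Filter Topology

/-- Differentiating the two algebraic relations along a curve. -/
lemma relations_deriv (α β γ δ ε ζ : ℝ) {u v X Y : ℝ → ℝ} {t u' v' X' Y' : ℝ}
    (hu : HasDerivAt u u' t) (hv : HasDerivAt v v' t)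
    (hX : HasDerivAt X X' t) (hY : HasDerivAt Y Y' t)
    (h1 : ∀ᶠ s in 𝓝 t,
      -ζ ^ 2 * u s * v s ^ 2 - 12 * β * ζ * u s * v s - ζ ^ 2 * u s ^ 3
        + 26 * α * ζ * u s ^ 2 - 192 * α ^ 2 * u s + 6 * α * ζ * v s ^ 2
        + 64 * α * β * v s - 32 * α * ε + γ * ζ + 2 * ζ * Y s = 0)
    (h2 : ∀ᶠ s in 𝓝 t,
      ζ ^ 2 * u s ^ 2 * v s - 12 * α * ζ * u s * v s + ζ ^ 2 * v s ^ 3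
        + 26 * β * ζ * v s ^ 2 + 192 * β ^ 2 * v s + 6 * β * ζ * u s ^ 2
        - 64 * α * β * u s + 32 * β * ε + δ * ζ + 2 * ζ * X s = 0) :
    (-ζ ^ 2 * v t ^ 2 - 12 * β * ζ * v t - 3 * ζ ^ 2 * u t ^ 2 + 52 * α * ζ * u t
        - 192 * α ^ 2) * u'
      + (-2 * ζ ^ 2 * u t * v t - 12 * β * ζ * u t + 12 * α * ζ * v t + 64 * α * β) * v'
      + 2 * ζ * Y' = 0 ∧
    -(-2 * ζ ^ 2 * u t * v t - 12 * β * ζ * u t + 12 * α * ζ * v t + 64 * α * β) * u'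
      + (ζ ^ 2 * u t ^ 2 - 12 * α * ζ * u t + 3 * ζ ^ 2 * v t ^ 2 + 52 * β * ζ * v t
        + 192 * β ^ 2) * v'
      + 2 * ζ * X' = 0 := by
  have d1 := ((((((((((hu.const_mul (-ζ ^ 2)).mul (hv.pow 2)).sub
    ((hu.const_mul (12 * β * ζ)).mul hv)).sub ((hu.pow 3).const_mul (ζ ^ 2))).add
    ((hu.pow 2).const_mul (26 * α * ζ))).sub (hu.const_mul (192 * α ^ 2))).add
    ((hv.pow 2).const_mul (6 * α * ζ))).add (hv.const_mul (64 * α * β))).sub_const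
    (32 * α * ε)).add_const (γ * ζ)).add (hY.const_mul (2 * ζ))
  have d2 := (((((((((((hu.pow 2).const_mul (ζ ^ 2)).mul hv).sub
    ((hu.const_mul (12 * α * ζ)).mul hv)).add ((hv.pow 3).const_mul (ζ ^ 2))).add
    ((hv.pow 2).const_mul (26 * β * ζ))).add (hv.const_mul (192 * β ^ 2))).add
    ((hu.pow 2).const_mul (6 * β * ζ))).sub (hu.const_mul (64 * α * β))).add_const
    (32 * β * ε)).add_const (δ * ζ)).add (hX.const_mul (2 * ζ))
  have e1 := d1.unique ((hasDerivAt_const t (0 : ℝ)).congr_of_eventuallyEq h1)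
  have e2 := d2.unique ((hasDerivAt_const t (0 : ℝ)).congr_of_eventuallyEq h2)
  simp only [Pi.pow_apply] at e1 e2
  norm_num at e1 e2
  constructor
  · linear_combination e1
  · linear_combination e2

/-- Derivative of `Λ` along a curve. -/
lemma hasDerivAt_lambda (α β ζ : ℝ) {u v : ℝ → ℝ} {t u' v' : ℝ}
    (hu : HasDerivAt u u' t) (hv : HasDerivAt v v' t) :
    HasDerivAt
      (fun s => (-(ζ * u s ^ 2) - ζ * v s ^ 2 + 16 * α * u s - 16 * β * v s) / (2 * ζ))
      ((-(2 * ζ * u t * u') - 2 * ζ * v t * v' + 16 * α * u' - 16 * β * v') / (2 * ζ)) t := by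
  have h := ((((((hu.pow 2).const_mul ζ).neg.sub ((hv.pow 2).const_mul ζ)).add
    (hu.const_mul (16 * α))).sub (hv.const_mul (16 * β))).div_const (2 * ζ))
  refine h.congr_deriv ?_
  norm_num
  ring

/-- Derivative of `u₀` along a curve. -/
lemma hasDerivAt_u₀ (α β ε ζ : ℝ) {u v : ℝ → ℝ} {t u' v' : ℝ}
    (hu : HasDerivAt u u' t) (hv : HasDerivAt v v' t) :
    HasDerivAt (fun s => 4 * (2 * α * u s + 2 * β * v s + ε) / ζ)
      (4 * (2 * α * u' + 2 * β * v') / ζ) t :=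
  ((((hu.const_mul (2 * α)).add (hv.const_mul (2 * β))).add_const ε).const_mul 4).div_const ζ

lemma hasDerivAt_pdx {f : ℝ × ℝ → ℝ} {p : ℝ × ℝ} (hf : DifferentiableAt ℝ f p) :
    HasDerivAt (fun t => f (t, p.2)) (pdx f p) p.1 :=
  (DifferentiableAt.comp p.1 (f := fun t : ℝ => (t, p.2)) (g := f) hf
    (by fun_prop)).hasDerivAt

lemma hasDerivAt_pdy {f : ℝ × ℝ → ℝ} {p : ℝ × ℝ} (hf : DifferentiableAt ℝ f p) :
    HasDerivAt (fun t => f (p.1, t)) (pdy f p) p.2 :=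
  (DifferentiableAt.comp p.2 (f := fun t : ℝ => (p.1, t)) (g := f) hf
    (by fun_prop)).hasDerivAt

/-- Solving the linear system for the partial derivatives of `f` and `g`. -/
lemma exists_scale_of_linear_system {a b d c fx gx fy gy : ℝ} (hc : c ≠ 0)
    (h1 : a * fx + b * gx = 0) (h2 : -b * fx + d * gx + c = 0)
    (h3 : a * fy + b * gy + c = 0) (h4 : -b * fy + d * gy = 0) :
    ∃ k : ℝ, fx = k * b ∧ gx = -k * a ∧ fy = -k * d ∧ gy = -k * b := by
  have hdet : a * d + b ^ 2 ≠ 0 := by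
    intro h
    have ha : a = 0 := by
      have : c * a = 0 := by linear_combination a * h2 + b * h1 - gx * h
      simpa [hc] using this
    have hb : b = 0 := by
      have : c * b = 0 := by linear_combination b * h2 - d * h1 + fx * h
      simpa [hc] using this
    exact hc (by simpa [ha, hb] using h3)
  refine ⟨c / (a * d + b ^ 2), ?_, ?_, ?_, ?_⟩
  · field_simp
    linear_combination d * h1 - b * h2
  · field_simp
    linear_combination b * h1 + a * h2
  · field_simp
    linear_combination d * h3 - b * h4
  · field_simp
    linear_combination b * h3 + a * h4

/-- Solutions of the algebraic system (4.3), (4.4) produced by the generalized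
hodograph method solve the semi-Hamiltonian system (4.1). -/
theorem statement4 (α β γ δ ε ζ : ℝ) (hζ : ζ ≠ 0)
    (U : Set (ℝ × ℝ)) (hU : IsOpen U)
    (f g : ℝ × ℝ → ℝ) (hf : ContDiffOn ℝ 1 f U) (hg : ContDiffOn ℝ 1 g U)
    (h43 : ∀ p ∈ U,
      -ζ ^ 2 * f p * g p ^ 2 - 12 * β * ζ * f p * g p - ζ ^ 2 * f p ^ 3
        + 26 * α * ζ * f p ^ 2 - 192 * α ^ 2 * f p + 6 * α * ζ * g p ^ 2
        + 64 * α * β * g p - 32 * α * ε + γ * ζ + 2 * ζ * p.2 = 0)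
    (h44 : ∀ p ∈ U,
      ζ ^ 2 * f p ^ 2 * g p - 12 * α * ζ * f p * g p + ζ ^ 2 * g p ^ 3
        + 26 * β * ζ * g p ^ 2 + 192 * β ^ 2 * g p + 6 * β * ζ * f p ^ 2
        - 64 * α * β * f p + 32 * β * ε + δ * ζ + 2 * ζ * p.1 = 0)
    (Λ u₀ : ℝ × ℝ → ℝ)
    (hΛdef : Λ = fun p => (-(ζ * f p ^ 2) - ζ * g p ^ 2 + 16 * α * f p - 16 * β * g p) / (2 * ζ))
    (hu₀def : u₀ = fun p => 4 * (2 * α * f p + 2 * β * g p + ε) / ζ) :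
    ∀ p ∈ U,
      pdx f p + pdy g p = 0 ∧
      f p * pdx Λ p + Λ p * pdx f p - g p * pdy Λ p - Λ p * pdy g p = 0 ∧
      2 * pdx Λ p + pdx u₀ p + (g p / 2) * pdx g p - (g p / 2) * pdy f p = 0 ∧
      -(f p / 2) * pdx g p + 2 * pdy Λ p - pdy u₀ p + (f p / 2) * pdy f p = 0 := by
  intro p hp
  have hUp : U ∈ 𝓝 p := hU.mem_nhds hp
  have hfp := (hf.contDiffAt hUp).differentiableAt one_ne_zero
  have hgp := (hg.contDiffAt hUp).differentiableAt one_ne_zero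
  have hfx := hasDerivAt_pdx hfp
  have hgx := hasDerivAt_pdx hgp
  have hfy := hasDerivAt_pdy hfp
  have hgy := hasDerivAt_pdy hgp
  have hcx : ∀ᶠ t in 𝓝 p.1, (t, p.2) ∈ U :=
    (show Continuous fun t : ℝ => (t, p.2) by fun_prop).continuousAt.eventually_mem hUp
  have hcy : ∀ᶠ t in 𝓝 p.2, (p.1, t) ∈ U :=
    (show Continuous fun t : ℝ => (p.1, t) by fun_prop).continuousAt.eventually_mem hUp
  obtain ⟨h1, h2⟩ := relations_deriv α β γ δ ε ζ hfx hgx (hasDerivAt_id' p.1)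
    (hasDerivAt_const p.1 p.2) (hcx.mono fun t ht => h43 _ ht) (hcx.mono fun t ht => h44 _ ht)
  obtain ⟨h3, h4⟩ := relations_deriv α β γ δ ε ζ hfy hgy (hasDerivAt_const p.2 p.1)
    (hasDerivAt_id' p.2) (hcy.mono fun t ht => h43 _ ht) (hcy.mono fun t ht => h44 _ ht)
  simp only [mul_zero, mul_one, add_zero] at h1 h2 h3 h4
  obtain ⟨k, e1, e2, e3, e4⟩ :=
    exists_scale_of_linear_system (mul_ne_zero two_ne_zero hζ) h1 h2 h3 h4
  have hΛx : pdx Λ p = _ :=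
    (congrArg (pdx · p) hΛdef).trans (hasDerivAt_lambda α β ζ hfx hgx).deriv
  have hΛy : pdy Λ p = _ :=
    (congrArg (pdy · p) hΛdef).trans (hasDerivAt_lambda α β ζ hfy hgy).deriv
  have hu₀x : pdx u₀ p = _ :=
    (congrArg (pdx · p) hu₀def).trans (hasDerivAt_u₀ α β ε ζ hfx hgx).deriv
  have hu₀y : pdy u₀ p = _ :=
    (congrArg (pdy · p) hu₀def).trans (hasDerivAt_u₀ α β ε ζ hfy hgy).deriv
  have hΛp := congrFun hΛdef p
  simp only [Prod.mk.eta] at hΛx hΛy hu₀x hu₀y e1 e2 e3 e4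
  rw [hΛx, hΛy, hu₀x, hu₀y, hΛp, e1, e2, e3, e4]
  refine ⟨by ring, ?_, ?_, ?_⟩ <;> field_simp <;> ring
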